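/- Let F be a field with char F ≠ 2 and k ≥ 2. Let H be the k×(k+1) circulant Hankel matrix over F[x_0,…,x_k] with entries H i j = x_{(i+j) mod (k+1)} for i ∈ Fin k, j ∈ Fin (k+1). Then the ideal Q generated by the permanents of all 2×2 submatrices of H has height k+1 in F[x_0,…,x_k]; equivalently, the variety {prk(H) ≤ 1} consists only of the origin. -/

import Mathlib

open MvPolynomial

noncomputable section

/-- The permanent of a square matrix. -/
def perm {R : Type*} [CommRing R] {m : ℕ} (A : Matrix (Fin m) (Fin m) R) : R :=
  ∑ σ : Equiv.Perm (Fin m), ∏ i, A i (σ i)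

/-- The height of an ideal: the infimum of the heights (in the prime spectrum)
of the primes containing it. -/
def idealHeight {R : Type*} [CommRing R] (I : Ideal R) : ℕ∞ :=
  ⨅ (p : PrimeSpectrum R) (_ : I ≤ p.asIdeal), Order.height p

/-- The `k × (k+1)` circulant Hankel matrix in the `k + 1` variables `x_0, …, x_k`,
with entries `H i j = x_{(i+j) mod (k+1)}`. -/
def circulantHankel (F : Type*) [Field F] (k : ℕ) :
    Matrix (Fin k) (Fin (k + 1)) (MvPolynomial (Fin (k + 1)) F) :=
  Matrix.of fun i j => X ⟨(i.val + j.val) % (k + 1), Nat.mod_lt _ (Nat.succ_pos k)⟩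

/-- The ideal generated by the permanents of all `2 × 2` submatrices of the circulant
Hankel matrix. -/
def circulantHankelPermIdeal (F : Type*) [Field F] (k : ℕ) :
    Ideal (MvPolynomial (Fin (k + 1)) F) :=
  Ideal.span { p | ∃ (r : Fin 2 → Fin k) (c : Fin 2 → Fin (k + 1)),
    StrictMono r ∧ StrictMono c ∧
    p = perm (Matrix.of fun a b => circulantHankel F k (r a) (c b)) }

theorem perm_fin_two {R : Type*} [CommRing R] (A : Matrix (Fin 2) (Fin 2) R) :
    perm A = A 0 0 * A 1 1 + A 0 1 * A 1 0 := by
  have h : (Finset.univ : Finset (Equiv.Perm (Fin 2))) = {1, Equiv.swap 0 1} := by decide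
  rw [perm, h, Finset.sum_pair (by decide)]
  simp [Fin.prod_univ_two]

theorem circulantHankel_apply (F : Type*) [Field F] (k : ℕ) (i : Fin k) (j : Fin (k + 1)) :
    circulantHankel F k i j = X (i.castSucc + j) := by
  simp only [circulantHankel, Matrix.of_apply]
  congr 1

/-- Products of two variables with the same index sum are negatives of each other modulo the
ideal of `2 × 2` permanents of the circulant Hankel matrix. -/
theorem X_mul_X_add_mem_circulantHankelPermIdeal (F : Type*) [Field F] (k : ℕ) (hk : 2 ≤ k)
    {a b d : Fin (k + 1)} (hab : a ≠ b) (hd : d ≠ 0) :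
    (X a * X (b + d) + X b * X (a + d) : MvPolynomial (Fin (k + 1)) F) ∈
      circulantHankelPermIdeal F k := by
  have small : ∀ a b d : Fin (k + 1), a < b → d ≠ 0 → d.val < k →
      (X a * X (b + d) + X b * X (a + d) : MvPolynomial (Fin (k + 1)) F) ∈
        circulantHankelPermIdeal F k := by
    intro a b d hab hd hdk
    apply Ideal.subset_span
    refine ⟨![⟨0, by omega⟩, ⟨d.val, hdk⟩], ![a, b], ?_, ?_, ?_⟩
    · rw [Fin.strictMono_iff_lt_succ]
      intro i
      fin_cases i
      have hpos : 0 < d.val := Nat.pos_of_ne_zero (Fin.val_ne_zero_iff.mpr hd)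
      exact hpos
    · rw [Fin.strictMono_iff_lt_succ]
      intro i
      fin_cases i
      simpa using hab
    · have h0 : (⟨0, by omega⟩ : Fin k).castSucc = 0 := rfl
      have h1 : (⟨d.val, hdk⟩ : Fin k).castSucc = d := rfl
      rw [perm_fin_two]
      simp only [Matrix.of_apply, circulantHankel_apply, Matrix.cons_val_zero,
        Matrix.cons_val_one, h0, h1, zero_add, add_comm d]
  have small' : ∀ a b d : Fin (k + 1), a ≠ b → d ≠ 0 → d.val < k →
      (X a * X (b + d) + X b * X (a + d) : MvPolynomial (Fin (k + 1)) F) ∈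
        circulantHankelPermIdeal F k := by
    intro a b d hab hd hdk
    rcases lt_or_gt_of_ne hab with h | h
    · exact small a b d h hd hdk
    · rw [add_comm (X a * X (b + d))]
      exact small b a d h hd hdk
  by_cases hdk : d.val < k
  · exact small' a b d hab hd hdk
  · have hd1 : d + 1 = 0 := by
      have : d = Fin.last k := by ext; simp; omega
      rw [this, Fin.last_add_one]
    have hv : (1 : Fin (k + 1)).val = 1 := by
      rw [Fin.val_one', Nat.mod_eq_of_lt (by omega)]
    have h := small' (a + d) (b + d) 1 (by simpa using hab)
      (by intro h; rw [h] at hv; simp at hv) (by omega)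
    rw [add_assoc, add_assoc, hd1, add_zero, add_zero] at h
    convert h using 1
    ring

/-- Every prime containing the `2 × 2` permanents of the circulant Hankel matrix contains all
the variables. -/
theorem X_mem_of_circulantHankelPermIdeal_le (F : Type*) [Field F] (hF : ringChar F ≠ 2) (k : ℕ)
    (hk : 2 ≤ k) (p : Ideal (MvPolynomial (Fin (k + 1)) F)) [hp : p.IsPrime]
    (h : circulantHankelPermIdeal F k ≤ p) (u : Fin (k + 1)) : X u ∈ p := by
  have two : ∀ f : MvPolynomial (Fin (k + 1)) F, 2 * f ∈ p → f ∈ p := by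
    intro f hf
    have h2 : (2 : F) ≠ 0 := Ring.two_ne_zero hF
    have := p.mul_mem_left (C (2⁻¹ : F)) hf
    rwa [show (2 : MvPolynomial (Fin (k + 1)) F) = C 2 from (map_ofNat C 2).symm, ← mul_assoc, ← C_mul,
      inv_mul_cancel₀ h2, C_1, one_mul] at this
  have rel : ∀ {a b d : Fin (k + 1)}, a ≠ b → d ≠ 0 →
      (X a * X (b + d) + X b * X (a + d) : MvPolynomial (Fin (k + 1)) F) ∈ p :=
    fun hab hd => h (X_mul_X_add_mem_circulantHankelPermIdeal F k hk hab hd)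
  rcases hk.eq_or_lt with rfl | hk3
  · have e0 := rel (a := 0) (b := 2) (d := 1) (by decide) (by decide)
    have e1 := rel (a := 1) (b := 0) (d := 1) (by decide) (by decide)
    have e2 := rel (a := 2) (b := 1) (d := 1) (by decide) (by decide)
    rw [show (2 + 1 : Fin 3) = 0 from rfl, show (0 + 1 : Fin 3) = 1 from rfl] at e0
    rw [show (0 + 1 : Fin 3) = 1 from rfl, show (1 + 1 : Fin 3) = 2 from rfl] at e1
    rw [show (1 + 1 : Fin 3) = 2 from rfl, show (2 + 1 : Fin 3) = 0 from rfl] at e2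
    have hP : (X 0 * X 1 * X 2 : MvPolynomial (Fin 3) F) ∈ p := by
      apply hp.mem_of_pow_mem 2
      apply two
      have m0 := p.mul_mem_left (X 1 ^ 2 * X 2 ^ 2) e0
      have m1 := p.mul_mem_left (X 2 * X 1 * X 2 ^ 2) e1
      have m2 := p.mul_mem_left (X 2 * X 1 * (X 0 * X 2)) e2
      convert p.add_mem (p.sub_mem m0 m1) m2 using 1
      ring
    fin_cases u
    · apply hp.mem_of_pow_mem 3
      convert p.sub_mem (p.mul_mem_left (X 0) e0) hP using 1
      simp only [Fin.zero_eta]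
      ring
    · apply hp.mem_of_pow_mem 3
      convert p.sub_mem (p.mul_mem_left (X 1) e1) hP using 1
      simp only [Fin.mk_one]
      ring
    · apply hp.mem_of_pow_mem 3
      convert p.sub_mem (p.mul_mem_left (X 2) e2) hP using 1
      simp only [Fin.reduceFinMk]
      ring
  · have v1 : (1 : Fin (k + 1)).val = 1 := by
      rw [Fin.val_one', Nat.mod_eq_of_lt (by omega)]
    have v2 : (1 + 1 : Fin (k + 1)).val = 2 := by
      rw [Fin.val_add, v1, Nat.mod_eq_of_lt (by omega)]
    have v3 : (1 + 1 + 1 : Fin (k + 1)).val = 3 := by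
      rw [Fin.val_add, v2, v1, Nat.mod_eq_of_lt (by omega)]
    have n1 : (1 : Fin (k + 1)) ≠ 0 := Fin.val_ne_zero_iff.mp (by omega)
    have n2 : (1 + 1 : Fin (k + 1)) ≠ 0 := Fin.val_ne_zero_iff.mp (by omega)
    have n3 : (1 + 1 + 1 : Fin (k + 1)) ≠ 0 := Fin.val_ne_zero_iff.mp (by omega)
    have e1 := rel (a := u) (b := u - 1) (d := 1)
      (fun h => n1 (by rwa [eq_comm, sub_eq_self] at h)) n1
    have e2 := rel (a := u) (b := u - (1 + 1)) (d := 1 + 1)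
      (fun h => n2 (by rwa [eq_comm, sub_eq_self] at h)) n2
    have e3 := rel (a := u - (1 + 1)) (b := u - 1) (d := 1 + 1 + 1)
      (fun h => n1 (by rw [sub_right_inj] at h; simpa using h)) n3
    rw [sub_add_cancel] at e1 e2
    rw [show u - 1 + (1 + 1 + 1) = u + (1 + 1) by abel,
      show u - (1 + 1) + (1 + 1 + 1) = u + 1 by abel] at e3
    apply hp.mem_of_pow_mem 2
    apply two
    convert p.sub_mem (p.add_mem e1 e2) e3 using 1
    ring

/-- The substitution killing the first `j` variables. -/
def killInitialVars (F : Type*) [Field F] (n j : ℕ) :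
    MvPolynomial (Fin n) F →ₐ[F] MvPolynomial (Fin n) F :=
  aeval fun i => if i.val < j then 0 else X i

theorem killInitialVars_X (F : Type*) [Field F] (n j : ℕ) (i : Fin n) :
    killInitialVars F n j (X i) = if i.val < j then 0 else X i := by
  simp [killInitialVars]

theorem le_height_ker_killInitialVars (F : Type*) [Field F] (n j : ℕ) (hj : j ≤ n) :
    (j : ℕ∞) ≤ (RingHom.ker (killInitialVars F n j)).height := by
  induction j with
  | zero => simp
  | succ j ih =>
    have hlt : RingHom.ker (killInitialVars F n j) < RingHom.ker (killInitialVars F n (j + 1)) := by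
      refine lt_of_le_of_ne ?_ ?_
      · have hc : (killInitialVars F n (j + 1)).comp (killInitialVars F n j) =
            killInitialVars F n (j + 1) := by
          ext1 i
          rw [AlgHom.comp_apply, killInitialVars_X]
          split_ifs with h
          · rw [map_zero, killInitialVars_X, if_pos (by omega)]
          · rfl
        intro f hf
        rw [RingHom.mem_ker] at hf ⊢
        rw [← hc, AlgHom.comp_apply, hf, map_zero]
      · intro he
        have hX : (X ⟨j, hj⟩ : MvPolynomial (Fin n) F) ∈
            RingHom.ker (killInitialVars F n (j + 1)) := by
          rw [RingHom.mem_ker, killInitialVars_X, if_pos (by simp)]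
        rw [← he, RingHom.mem_ker, killInitialVars_X, if_neg (by simp)] at hX
        exact X_ne_zero _ hX
    have : (RingHom.ker (killInitialVars F n j)).IsPrime := RingHom.ker_isPrime _
    have : (RingHom.ker (killInitialVars F n (j + 1))).IsPrime := RingHom.ker_isPrime _
    push_cast
    exact (add_le_add_left (ih (by omega)) 1).trans
      (Ideal.height_add_one_le_of_lt_of_isPrime hlt)

theorem ker_killInitialVars_le (F : Type*) [Field F] (n : ℕ)
    (p : Ideal (MvPolynomial (Fin n) F)) (h : ∀ i, X i ∈ p) :
    RingHom.ker (killInitialVars F n n) ≤ p := by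
  have hc : (Ideal.Quotient.mkₐ F p).comp (killInitialVars F n n) = Ideal.Quotient.mkₐ F p := by
    ext1 i
    rw [AlgHom.comp_apply, killInitialVars_X, if_pos i.isLt, map_zero]
    exact (Ideal.Quotient.eq_zero_iff_mem.mpr (h i)).symm
  intro f hf
  rw [RingHom.mem_ker] at hf
  have : Ideal.Quotient.mkₐ F p f = 0 := by rw [← hc, AlgHom.comp_apply, hf, map_zero]
  exact Ideal.Quotient.eq_zero_iff_mem.mp this

theorem circulantHankelPermIdeal_le_ker (F : Type*) [Field F] (k : ℕ) :
    circulantHankelPermIdeal F k ≤ RingHom.ker (killInitialVars F (k + 1) (k + 1)) := by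
  refine Ideal.span_le.mpr ?_
  rintro _ ⟨r, c, -, -, rfl⟩
  have h0 : ∀ i, killInitialVars F (k + 1) (k + 1) (X i) = 0 := fun i => by
    rw [killInitialVars_X, if_pos i.isLt]
  simp [RingHom.mem_ker, perm_fin_two, circulantHankel_apply, h0]

/-- For a field `F` with `char F ≠ 2` and `k ≥ 2`, the ideal of `2 × 2` permanents of the
`k × (k+1)` circulant Hankel matrix has height `k + 1` in `F[x_0,…,x_k]`: the variety
`{prk(H) ≤ 1}` consists only of the origin. -/
theorem statement10 (F : Type*) [Field F] (hF : ringChar F ≠ 2) (k : ℕ) (hk : 2 ≤ k) :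
    idealHeight (circulantHankelPermIdeal F k) = ((k + 1 : ℕ) : ℕ∞) := by
  apply le_antisymm
  · have hp : (RingHom.ker (killInitialVars F (k + 1) (k + 1))).IsPrime := RingHom.ker_isPrime _
    refine (iInf₂_le (⟨_, hp⟩ : PrimeSpectrum _) (circulantHankelPermIdeal_le_ker F k)).trans ?_
    rw [← PrimeSpectrum.height_eq_orderHeight]
    have h := Ideal.height_le_ringKrullDim_of_isPrime
      (I := RingHom.ker (killInitialVars F (k + 1) (k + 1)))
    rw [MvPolynomial.ringKrullDim_of_isNoetherianRing, ringKrullDim_eq_zero_of_field, zero_add,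
      Nat.card_fin] at h
    exact_mod_cast h
  · refine le_iInf₂ fun p hp => ?_
    rw [← PrimeSpectrum.height_eq_orderHeight]
    exact (le_height_ker_killInitialVars F (k + 1) (k + 1) le_rfl).trans
      (Ideal.height_mono (ker_killInitialVars_le F (k + 1) p.asIdeal
        (X_mem_of_circulantHankelPermIdeal_le F hF k hk p.asIdeal hp)))

end
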